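/- Let p ≥ 3 be a prime and r ≥ p with r ≡ a mod (p−1), 1 ≤ a ≤ p−1. Then there is a short exact sequence of Γ-equivariant F_p-linear maps 0 → V_a → V_r/V_r^* → V_{p−a−1} ⊗ D^a → 0, and this sequence splits as a sequence of Γ-modules if and only if a = p−1. -/

import Mathlib

open MvPolynomial

/-- The action of a 2×2 matrix `g` over `F_p` on polynomials in two variables:
`((a b; c d) · F)(X, Y) = F (aX + cY, bX + dY)`. -/
noncomputable def matAct (p : ℕ) (g : Matrix (Fin 2) (Fin 2) (ZMod p)) :
    MvPolynomial (Fin 2) (ZMod p) →ₐ[ZMod p] MvPolynomial (Fin 2) (ZMod p) :=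
  aeval fun i => ∑ j, C (g j i) * X j

/-- The action of `g` twisted by the `n`-th power of the determinant character `D`. -/
noncomputable def twAct (p n : ℕ) (g : Matrix (Fin 2) (Fin 2) (ZMod p))
    (F : MvPolynomial (Fin 2) (ZMod p)) : MvPolynomial (Fin 2) (ZMod p) :=
  g.det ^ n • matAct p g F

/-- `V_m`: homogeneous polynomials of degree `m` in two variables over `F_p`. -/
noncomputable def Vh (p m : ℕ) : Submodule (ZMod p) (MvPolynomial (Fin 2) (ZMod p)) :=
  homogeneousSubmodule (Fin 2) (ZMod p) m

/-- `X_r`: the `M`-submodule of `V_r` generated by `X^r`, realized as the span of the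
orbit of `X^r` under the monoid `M = M_2(F_p)`. -/
noncomputable def XrSub (p r : ℕ) : Submodule (ZMod p) (MvPolynomial (Fin 2) (ZMod p)) :=
  Submodule.span (ZMod p)
    (Set.range fun g : Matrix (Fin 2) (Fin 2) (ZMod p) => matAct p g (X 0 ^ r))

/-- `X_{r-1}`: the `M`-submodule of `V_r` generated by `X^{r-1} Y`. -/
noncomputable def Xr1Sub (p r : ℕ) : Submodule (ZMod p) (MvPolynomial (Fin 2) (ZMod p)) :=
  Submodule.span (ZMod p)
    (Set.range fun g : Matrix (Fin 2) (Fin 2) (ZMod p) => matAct p g (X 0 ^ (r - 1) * X 1))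

/-- The special polynomial `θ = X^p Y − X Y^p`. -/
noncomputable def theta (p : ℕ) : MvPolynomial (Fin 2) (ZMod p) :=
  X 0 ^ p * X 1 - X 0 * X 1 ^ p

/-- `V_r^* = {F ∈ V_r : θ ∣ F}`. -/
noncomputable def Vstar (p r : ℕ) : Submodule (ZMod p) (MvPolynomial (Fin 2) (ZMod p)) :=
  Vh p r ⊓ (Ideal.span {theta p}).restrictScalars (ZMod p)

/-- `V_r^{**} = {F ∈ V_r : θ² ∣ F}`. -/
noncomputable def Vdstar (p r : ℕ) : Submodule (ZMod p) (MvPolynomial (Fin 2) (ZMod p)) :=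
  Vh p r ⊓ (Ideal.span {theta p ^ 2}).restrictScalars (ZMod p)

/-- `M`-equivariance of a linear map between two submodules of the polynomial ring,
where the source carries the action twisted by `D^{nA}` and the target by `D^{nB}`. -/
def EquivMap (p nA nB : ℕ)
    {A B : Submodule (ZMod p) (MvPolynomial (Fin 2) (ZMod p))}
    (φ : A →ₗ[ZMod p] B) : Prop :=
  ∀ (g : Matrix (Fin 2) (Fin 2) (ZMod p)) (x y : A),
    (y : MvPolynomial (Fin 2) (ZMod p)) = twAct p nA g (x : MvPolynomial (Fin 2) (ZMod p)) →
    (φ y : MvPolynomial (Fin 2) (ZMod p)) = twAct p nB g (φ x : MvPolynomial (Fin 2) (ZMod p))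

section Polynomials

variable {p : ℕ}

theorem eval_matAct (g : Matrix (Fin 2) (Fin 2) (ZMod p)) (v : Fin 2 → ZMod p)
    (F : MvPolynomial (Fin 2) (ZMod p)) :
    eval v (matAct p g F) = eval (Matrix.vecMul v g) F := by
  induction F using MvPolynomial.induction_on with
  | C c => simp [matAct]
  | add F G hF hG => simp [hF, hG]
  | mul_X F i hF =>
    rw [map_mul, map_mul, hF, map_mul]
    simp [matAct, Matrix.vecMul, dotProduct, mul_comm]

theorem matAct_mem_Vh {m : ℕ} (g : Matrix (Fin 2) (Fin 2) (ZMod p))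
    {F : MvPolynomial (Fin 2) (ZMod p)} (hF : F ∈ Vh p m) : matAct p g F ∈ Vh p m := by
  have h := IsHomogeneous.aeval (n := 1) (S := ZMod p) ((mem_homogeneousSubmodule m F).1 hF)
    (fun i => ∑ j, C (g j i) * X j)
    (fun i => IsHomogeneous.sum _ _ _ fun j _ => isHomogeneous_C_mul_X _ _)
  rwa [one_mul] at h

theorem X_pow_mul_X_pow_mem_Vh {m i j : ℕ} (h : i + j = m) :
    (X 0 ^ i * X 1 ^ j : MvPolynomial (Fin 2) (ZMod p)) ∈ Vh p m := by
  subst h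
  exact (isHomogeneous_X_pow 0 i).mul (isHomogeneous_X_pow 1 j)

/-- The monomial `X ^ (m - k) * Y ^ k`, as an element of `V_m`. -/
noncomputable def Vh.mono (p m : ℕ) (k : Fin (m + 1)) : Vh p m :=
  ⟨X 0 ^ (m - k : ℕ) * X 1 ^ (k : ℕ), X_pow_mul_X_pow_mem_Vh (by omega)⟩

theorem Vh.coe_mono (m : ℕ) (k : Fin (m + 1)) :
    (Vh.mono p m k : MvPolynomial (Fin 2) (ZMod p)) =
      monomial (Finsupp.single 0 (m - k : ℕ) + Finsupp.single 1 (k : ℕ)) 1 := by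
  change X 0 ^ (m - k : ℕ) * X 1 ^ (k : ℕ) = _
  rw [X_pow_eq_monomial, X_pow_eq_monomial, monomial_mul, mul_one]

theorem Vh.linearIndependent_mono (m : ℕ) : LinearIndependent (ZMod p) (Vh.mono p m) := by
  apply LinearIndependent.of_comp (Vh p m).subtype
  have h := (basisMonomials (Fin 2) (ZMod p)).linearIndependent.comp
    (fun k : Fin (m + 1) => Finsupp.single 0 (m - k : ℕ) + Finsupp.single 1 (k : ℕ))
    (fun k l hkl => by
      have := DFunLike.congr_fun hkl 1
      simpa [Fin.val_inj] using this)
  have he : (Vh p m).subtype ∘ Vh.mono p m = basisMonomials (Fin 2) (ZMod p) ∘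
      fun k : Fin (m + 1) => Finsupp.single 0 (m - k : ℕ) + Finsupp.single 1 (k : ℕ) := by
    ext1 k
    rw [Function.comp_apply, Function.comp_apply, coe_basisMonomials]
    exact Vh.coe_mono m k
  rw [he]
  exact h

theorem Vh.span_mono (m : ℕ) : ⊤ ≤ Submodule.span (ZMod p) (Set.range (Vh.mono p m)) := by
  intro F _
  have key : F = ∑ k : Fin (m + 1),
      coeff (Finsupp.single 0 (m - k : ℕ) + Finsupp.single 1 (k : ℕ)) F.1 • Vh.mono p m k := by
    apply Subtype.ext
    ext d
    simp only [Submodule.coe_sum, Submodule.coe_smul, Vh.coe_mono, coeff_sum, coeff_smul,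
      coeff_monomial, smul_eq_mul, mul_ite, mul_one, mul_zero]
    by_cases hd : d.degree = m
    · have hd2 : d 0 + d 1 = m := by simpa [Finsupp.degree_eq_sum] using hd
      have hde : d = Finsupp.single 0 (m - d 1) + Finsupp.single 1 (d 1) := by
        ext i
        fin_cases i <;> simp; omega
      rw [Finset.sum_eq_single ⟨d 1, by omega⟩]
      · rw [← hde, if_pos rfl]
      · intro k _ hk
        rw [if_neg]
        intro h
        apply hk
        ext
        simp [← h]
      · simp
    · rw [IsHomogeneous.coeff_eq_zero ((mem_homogeneousSubmodule m _).1 F.2) hd]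
      symm
      apply Finset.sum_eq_zero
      intro k _
      rw [if_neg]
      rintro rfl
      apply hd
      simp only [map_add, Finsupp.degree_single]
      omega
  rw [key]
  exact Submodule.sum_mem _ fun k _ => Submodule.smul_mem _ _ (Submodule.subset_span ⟨k, rfl⟩)

/-- The monomial basis of `V_m`. -/
noncomputable def Vh.basis (p m : ℕ) : Module.Basis (Fin (m + 1)) (ZMod p) (Vh p m) :=
  Module.Basis.mk (Vh.linearIndependent_mono m) (Vh.span_mono m)

theorem Vh.basis_apply (m : ℕ) (k : Fin (m + 1)) : Vh.basis p m k = Vh.mono p m k := by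
  simp [Vh.basis]

theorem Vh.eval_mono (m : ℕ) (k : Fin (m + 1)) (v : Fin 2 → ZMod p) :
    eval v (Vh.mono p m k : MvPolynomial (Fin 2) (ZMod p)) =
      v 0 ^ (m - k : ℕ) * v 1 ^ (k : ℕ) := by
  simp [Vh.mono]

theorem eval_zero_of_mem_Vh {m : ℕ} (hm : 0 < m) {F : MvPolynomial (Fin 2) (ZMod p)}
    (hF : F ∈ Vh p m) : eval 0 F = 0 := by
  have h : coeff 0 F = 0 := IsHomogeneous.coeff_eq_zero ((mem_homogeneousSubmodule m _).1 hF)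
    (by simpa using hm.ne)
  simpa [constantCoeff_eq] using h

end Polynomials

section FiniteField

variable {p : ℕ} [Fact p.Prime]

theorem ZMod.pow_add_mul_card_sub_one {i : ℕ} (hi : 0 < i) (q : ℕ) (x : ZMod p) :
    x ^ (i + (p - 1) * q) = x ^ i := by
  by_cases hx : x = 0
  · subst hx
    rw [zero_pow (by omega), zero_pow (by omega)]
  · rw [pow_add, pow_mul, ZMod.pow_card_sub_one_eq_one hx, one_pow, mul_one]

theorem ZMod.sum_pow_of_dvd {i : ℕ} (hi : 0 < i) (h : p - 1 ∣ i) :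
    ∑ x : ZMod p, x ^ i = -1 := by
  have hx : ∀ x : ZMod p, x ^ i = 1 - if x = 0 then 1 else 0 := by
    intro x
    obtain ⟨q, rfl⟩ := h
    split_ifs with hx
    · subst hx
      rw [zero_pow (by omega), sub_self]
    · rw [pow_mul, ZMod.pow_card_sub_one_eq_one hx, one_pow, sub_zero]
  simp [hx]

theorem ZMod.sum_pow_of_not_dvd {i : ℕ} (h : ¬ p - 1 ∣ i) : ∑ x : ZMod p, x ^ i = 0 := by
  have hp : 1 < p := (Fact.out : p.Prime).one_lt
  have hpos : 0 < i % (p - 1) := Nat.pos_of_ne_zero fun h0 => h (Nat.dvd_of_mod_eq_zero h0)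
  have hlt : i % (p - 1) < p - 1 := Nat.mod_lt _ (by omega)
  conv_lhs => rw [← Nat.mod_add_div i (p - 1)]
  simp only [ZMod.pow_add_mul_card_sub_one hpos]
  exact FiniteField.sum_pow_lt_card_sub_one _ _ (by rwa [ZMod.card])

theorem sum_pow_mul_pow (s t : ℕ) :
    ∑ v : Fin 2 → ZMod p, v 0 ^ s * v 1 ^ t =
      (∑ x : ZMod p, x ^ s) * ∑ y : ZMod p, y ^ t := by
  rw [Finset.sum_mul_sum, ← Fintype.sum_prod_type']
  exact Fintype.sum_equiv (finTwoArrowEquiv _) _ _ fun v => rfl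

theorem eq_zero_of_sum_mul_pow_eq_zero {c : Fin p → ZMod p}
    (h : ∀ y : ZMod p, ∑ t, c t * y ^ (t : ℕ) = 0) : c = 0 := by
  have hP : (∑ t : Fin p, Polynomial.monomial (t : ℕ) (c t)) = 0 := by
    apply Polynomial.eq_zero_of_degree_lt_of_eval_finset_eq_zero Finset.univ
    · rw [Finset.card_univ, ZMod.card]
      refine (Polynomial.degree_sum_le _ _).trans_lt ?_
      refine (Finset.sup_lt_iff (WithBot.bot_lt_coe p)).2 fun t _ => ?_
      exact (Polynomial.degree_monomial_le _ _).trans_lt (WithBot.coe_lt_coe.2 t.2)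
    · intro y _
      simpa [Polynomial.eval_finsetSum] using h y
  ext s
  have := congrArg (fun P => Polynomial.coeff P s) hP
  simpa [Polynomial.finsetSum_coeff, Polynomial.coeff_monomial, Fin.val_inj] using this

end FiniteField

section Quotient

variable {p r : ℕ}

/-- The quotient `V_r / V_r^*`. -/
abbrev Vquot (p r : ℕ) : Type := ↥(Vh p r) ⧸ (Vstar p r).comap (Vh p r).subtype

theorem mem_comap_Vstar {F : Vh p r} :
    F ∈ (Vstar p r).comap (Vh p r).subtype ↔
      theta p ∣ (F : MvPolynomial (Fin 2) (ZMod p)) := by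
  simp [Vstar, Ideal.mem_span_singleton]

/-- The class of `X ^ (r - k) * Y ^ k` in `V_r / V_r^*`. -/
noncomputable def Vquot.mono (p r : ℕ) (k : Fin (r + 1)) : Vquot p r :=
  Submodule.Quotient.mk (Vh.mono p r k)

theorem Vquot.mono_eq_mono_sub (k : ℕ) (hpk : p ≤ k) (hkr : k < r) (hp : 2 ≤ p) :
    Vquot.mono p r ⟨k, by omega⟩ = Vquot.mono p r ⟨k - (p - 1), by omega⟩ := by
  refine (Submodule.Quotient.eq _).2 (mem_comap_Vstar.2 ?_)
  refine ⟨-(X 0 ^ (r - k - 1) * X 1 ^ (k - p)), ?_⟩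
  obtain ⟨i, rfl⟩ := Nat.exists_eq_add_of_le hpk
  obtain ⟨j, rfl⟩ := Nat.exists_eq_add_of_lt hkr
  have e1 : p + i + j + 1 - (p + i) = j + 1 := by omega
  have e2 : p + i - (p - 1) = i + 1 := by omega
  have e3 : p + i + j + 1 - (i + 1) = p + j := by omega
  have e4 : p + i + j + 1 - (p + i) - 1 = j := by omega
  have e5 : p + i - p = i := by omega
  simp only [Vh.mono, Submodule.coe_sub, e1, e2, e3, e5, theta, Nat.add_sub_cancel]
  ring

theorem Vquot.span_mono (hp : 2 ≤ p) (hpr : p ≤ r) :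
    Submodule.span (ZMod p)
        (Set.range fun t : Fin p => Vquot.mono p r ⟨t, by omega⟩) ⊔
      Submodule.span (ZMod p) {Vquot.mono p r (Fin.last r)} = ⊤ := by
  set W := Submodule.span (ZMod p)
        (Set.range fun t : Fin p => Vquot.mono p r ⟨t, by omega⟩) ⊔
      Submodule.span (ZMod p) {Vquot.mono p r (Fin.last r)}
  have hmono : ∀ k (hk : k < r + 1), Vquot.mono p r ⟨k, hk⟩ ∈ W := by
    intro k
    induction k using Nat.strong_induction_on with
    | _ k ih =>
      intro hk
      by_cases hkr : k = r
      · subst hkr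
        exact Submodule.mem_sup_right (Submodule.mem_span_singleton_self _)
      by_cases hkp : k < p
      · exact Submodule.mem_sup_left (Submodule.subset_span ⟨⟨k, hkp⟩, rfl⟩)
      · rw [Vquot.mono_eq_mono_sub k (by omega) (by omega) hp]
        exact ih _ (by omega) _
  rw [eq_top_iff, ← Submodule.range_mkQ, LinearMap.range_eq_map, Submodule.map_le_iff_le_comap]
  refine (Vh.span_mono r).trans (Submodule.span_le.2 ?_)
  rintro _ ⟨k, rfl⟩
  exact hmono k k.2

theorem Vquot.exists_eq_sum (hp : 2 ≤ p) (hpr : p ≤ r) (q : Vquot p r) :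
    ∃ (c : Fin p → ZMod p) (c' : ZMod p),
      ∑ t : Fin p, c t • Vquot.mono p r ⟨t, by omega⟩ + c' • Vquot.mono p r (Fin.last r) = q := by
  have hq : q ∈ (⊤ : Submodule (ZMod p) (Vquot p r)) := trivial
  rw [← Vquot.span_mono hp hpr] at hq
  obtain ⟨x, hx, y, hy, rfl⟩ := Submodule.mem_sup.1 hq
  obtain ⟨c, rfl⟩ := (Submodule.mem_span_range_iff_exists_fun _).1 hx
  obtain ⟨c', rfl⟩ := Submodule.mem_span_singleton.1 hy
  exact ⟨c, c', rfl⟩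

/-- Evaluation of polynomials in `V_m` at the points of the plane. -/
noncomputable def Vh.evalMap (p m : ℕ) : Vh p m →ₗ[ZMod p] ((Fin 2 → ZMod p) → ZMod p) :=
  LinearMap.pi fun v => (aeval v).toLinearMap ∘ₗ (Vh p m).subtype

theorem Vh.evalMap_apply {m : ℕ} (F : Vh p m) (v : Fin 2 → ZMod p) :
    Vh.evalMap p m F v = eval v (F : MvPolynomial (Fin 2) (ZMod p)) := by
  simp [Vh.evalMap]

variable [Fact p.Prime]

theorem eval_theta (v : Fin 2 → ZMod p) : eval v (theta p) = 0 := by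
  simp [theta, ZMod.pow_card]

theorem Vh.evalMap_injective {m : ℕ} (hm : m ≤ p) : Function.Injective (Vh.evalMap p m) := by
  rw [injective_iff_map_eq_zero]
  intro F hF
  apply Subtype.ext
  apply IsHomogeneous.eq_zero_of_forall_eval_eq_zero_of_le_card
    ((mem_homogeneousSubmodule m _).1 F.2)
  · intro v
    rw [← Vh.evalMap_apply, hF, Pi.zero_apply]
  · simpa [Cardinal.mk_fintype, ZMod.card] using hm

/-- Evaluation of classes in `V_r / V_r^*` at the points of the plane. -/
noncomputable def Vquot.evalMap (p r : ℕ) [Fact p.Prime] :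
    Vquot p r →ₗ[ZMod p] ((Fin 2 → ZMod p) → ZMod p) :=
  Submodule.liftQ _ (Vh.evalMap p r) <| by
    intro F hF
    obtain ⟨G, hG⟩ := mem_comap_Vstar.1 hF
    ext v
    rw [Vh.evalMap_apply, hG, map_mul, eval_theta, zero_mul, Pi.zero_apply]

theorem Vquot.evalMap_mk (F : Vh p r) (v : Fin 2 → ZMod p) :
    Vquot.evalMap p r (Submodule.Quotient.mk F) v =
      eval v (F : MvPolynomial (Fin 2) (ZMod p)) :=
  Vh.evalMap_apply F v

theorem Vquot.evalMap_mono (k : Fin (r + 1)) (v : Fin 2 → ZMod p) :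
    Vquot.evalMap p r (Vquot.mono p r k) v = v 0 ^ (r - k : ℕ) * v 1 ^ (k : ℕ) := by
  rw [Vquot.mono, Vquot.evalMap_mk, Vh.eval_mono]

theorem Vquot.evalMap_injective (hpr : p ≤ r) : Function.Injective (Vquot.evalMap p r) := by
  have hp : 2 ≤ p := (Fact.out : p.Prime).two_le
  rw [injective_iff_map_eq_zero]
  intro q hq
  obtain ⟨c, c', rfl⟩ := Vquot.exists_eq_sum hp hpr q
  have heval : ∀ v : Fin 2 → ZMod p,
      ∑ t : Fin p, c t * (v 0 ^ (r - t : ℕ) * v 1 ^ (t : ℕ)) + c' * v 1 ^ r = 0 := by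
    intro v
    simpa [Vquot.evalMap_mono] using congrFun hq v
  have hc' : c' = 0 := by
    have h := heval ![0, 1]
    rw [Finset.sum_eq_zero] at h
    · simpa using h
    · intro t _
      have : r - (t : ℕ) ≠ 0 := by omega
      simp [this]
  subst hc'
  have hc : c = 0 := eq_zero_of_sum_mul_pow_eq_zero fun y => by
    simpa using heval ![1, y]
  subst hc
  simp

theorem Vquot.eq_mk_iff (hpr : p ≤ r) {q : Vquot p r} {F : Vh p r} :
    q = Submodule.Quotient.mk F ↔
      ∀ v, Vquot.evalMap p r q v = eval v (F : MvPolynomial (Fin 2) (ZMod p)) := by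
  rw [← (Vquot.evalMap_injective hpr).eq_iff, funext_iff]
  simp only [Vquot.evalMap_mk]

end Quotient

section Sequence

variable {p : ℕ} [Fact p.Prime]

theorem exists_inclusion {a q : ℕ} (ha : 1 ≤ a) (hpr : p ≤ a + (p - 1) * q) :
    ∃ ι : Vh p a →ₗ[ZMod p] Vquot p (a + (p - 1) * q),
      ∀ x, Vquot.evalMap p _ (ι x) = Vh.evalMap p a x := by
  have hrange : ∀ x, Vh.evalMap p a x ∈ LinearMap.range (Vquot.evalMap p (a + (p - 1) * q)) := by
    intro x
    suffices h : (⊤ : Submodule (ZMod p) (Vh p a)) ≤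
        (LinearMap.range (Vquot.evalMap p (a + (p - 1) * q))).comap (Vh.evalMap p a) from
      h trivial
    refine (Vh.span_mono a).trans (Submodule.span_le.2 ?_)
    rintro _ ⟨k, rfl⟩
    by_cases hk : (k : ℕ) < a
    · refine ⟨Vquot.mono p _ ⟨k, by omega⟩, ?_⟩
      ext v
      have e : a + (p - 1) * q - k = a - k + (p - 1) * q := by omega
      rw [Vquot.evalMap_mono, Vh.evalMap_apply, Vh.eval_mono, e,
        ZMod.pow_add_mul_card_sub_one (by omega)]
    · refine ⟨Vquot.mono p _ (Fin.last _), ?_⟩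
      ext v
      have e : (k : ℕ) = a := by omega
      rw [Vquot.evalMap_mono, Vh.evalMap_apply, Vh.eval_mono, e, Fin.val_last,
        ZMod.pow_add_mul_card_sub_one ha]
      simp
  refine ⟨(LinearEquiv.ofInjective _ (Vquot.evalMap_injective hpr)).symm.toLinearMap ∘ₗ
    (Vh.evalMap p a).codRestrict _ hrange, fun x => ?_⟩
  exact congrArg Subtype.val ((LinearEquiv.ofInjective _
    (Vquot.evalMap_injective hpr)).apply_symm_apply ((Vh.evalMap p a).codRestrict _ hrange x))

/-- The linear form `v₀ Y - v₁ X`, the determinant of `v` and `(X, Y)`. -/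
noncomputable def detForm (v : Fin 2 → ZMod p) : MvPolynomial (Fin 2) (ZMod p) :=
  C (v 0) * X 1 - C (v 1) * X 0

theorem matAct_detForm_vecMul (g : Matrix (Fin 2) (Fin 2) (ZMod p)) (v : Fin 2 → ZMod p) :
    matAct p g (detForm (Matrix.vecMul v g)) = g.det • detForm v := by
  simp only [detForm, matAct, Matrix.vecMul, dotProduct, Fin.sum_univ_two, map_sub, map_mul,
    aeval_X, algHom_C, algebraMap_eq, Matrix.det_fin_two, smul_eq_C_mul, map_add]
  ring

theorem detForm_pow (n : ℕ) (v : Fin 2 → ZMod p) :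
    detForm v ^ n = ∑ k : Fin (n + 1),
      (v 0 ^ (k : ℕ) * v 1 ^ (n - k : ℕ) * ((-1) ^ (n - k : ℕ) * (n.choose k : ZMod p))) •
        (Vh.mono p n k : MvPolynomial (Fin 2) (ZMod p)) := by
  rw [detForm, sub_eq_add_neg, add_pow, Finset.sum_range]
  refine Finset.sum_congr rfl fun k _ => ?_
  simp only [Vh.mono, smul_eq_C_mul, map_mul, map_pow, map_neg, map_one, map_natCast]
  rw [neg_pow (C (v 1) * X 0), mul_pow, mul_pow]
  ring

theorem detForm_pow_mem_Vh (n : ℕ) (v : Fin 2 → ZMod p) : detForm v ^ n ∈ Vh p n := by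
  rw [detForm_pow]
  exact Submodule.sum_mem _ fun k _ => Submodule.smul_mem _ _ (Vh.mono p n k).2

/-- The transform `f ↦ ∑ v, f v • (v₀ Y - v₁ X) ^ n` from functions on the plane to `V_n`. -/
noncomputable def planeTransform (p n : ℕ) [Fact p.Prime] :
    ((Fin 2 → ZMod p) → ZMod p) →ₗ[ZMod p] Vh p n :=
  ∑ v, (LinearMap.proj v).smulRight (⟨detForm v ^ n, detForm_pow_mem_Vh n v⟩ : Vh p n)

theorem coe_planeTransform (n : ℕ) (f : (Fin 2 → ZMod p) → ZMod p) :
    (planeTransform p n f : MvPolynomial (Fin 2) (ZMod p)) = ∑ v, f v • detForm v ^ n := by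
  simp [planeTransform]

theorem matAct_planeTransform (n : ℕ) {g : Matrix (Fin 2) (Fin 2) (ZMod p)} (hg : IsUnit g)
    (f : (Fin 2 → ZMod p) → ZMod p) :
    matAct p g (planeTransform p n f) =
      g.det ^ n • (planeTransform p n fun v => f (Matrix.vecMul v g) :
        MvPolynomial (Fin 2) (ZMod p)) := by
  have hbij : Function.Bijective fun v : Fin 2 → ZMod p => Matrix.vecMul v g :=
    Finite.injective_iff_bijective.1 (Matrix.vecMul_injective_iff_isUnit.2 hg)
  simp only [coe_planeTransform, map_sum, map_smul, map_pow, Finset.smul_sum]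
  symm
  refine Fintype.sum_bijective _ hbij _ _ fun v => ?_
  rw [matAct_detForm_vecMul, smul_pow, smul_comm]

theorem planeTransform_monomial (n i j : ℕ) :
    planeTransform p n (fun v => v 0 ^ i * v 1 ^ j) = ∑ k : Fin (n + 1),
      ((∑ x : ZMod p, x ^ (i + k)) * (∑ y : ZMod p, y ^ (j + (n - k))) *
        ((-1) ^ (n - k : ℕ) * (n.choose k : ZMod p))) • Vh.mono p n k := by
  apply Subtype.ext
  simp only [coe_planeTransform, detForm_pow, Finset.smul_sum, Submodule.coe_sum,
    Submodule.coe_smul]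
  rw [Finset.sum_comm]
  refine Finset.sum_congr rfl fun k _ => ?_
  rw [← sum_pow_mul_pow, Finset.sum_mul, Finset.sum_smul]
  refine Finset.sum_congr rfl fun v _ => ?_
  rw [smul_smul]
  congr 1
  ring

theorem planeTransform_evalMap {a n : ℕ} (ha : 1 ≤ a) (han : a + n = p - 1) (x : Vh p a) :
    planeTransform p n (Vh.evalMap p a x) = 0 := by
  suffices h : planeTransform p n ∘ₗ Vh.evalMap p a = 0 from LinearMap.congr_fun h x
  refine (Vh.basis p a).ext fun j => ?_
  have e : Vh.evalMap p a (Vh.basis p a j) = fun v => v 0 ^ (a - j : ℕ) * v 1 ^ (j : ℕ) := by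
    ext v
    rw [Vh.basis_apply, Vh.evalMap_apply, Vh.eval_mono]
  rw [LinearMap.comp_apply, e, planeTransform_monomial, LinearMap.zero_apply]
  refine Finset.sum_eq_zero fun k _ => ?_
  suffices h : (∑ x : ZMod p, x ^ (a - j + k : ℕ)) *
      (∑ y : ZMod p, y ^ (j + (n - k) : ℕ)) = 0 by rw [h, zero_mul, zero_smul]
  have hlt : ∀ i : ℕ, i < p - 1 → ∑ x : ZMod p, x ^ i = 0 := fun i hi =>
    FiniteField.sum_pow_lt_card_sub_one _ _ (by rwa [ZMod.card])
  by_cases h : (a - j + k : ℕ) < p - 1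
  · rw [hlt _ h, zero_mul]
  · rw [hlt (j + (n - k)) (by omega), mul_zero]

theorem planeTransform_evalMap_mono {a n q : ℕ} (ha : 1 ≤ a) (han : a + n = p - 1)
    (hpr : p ≤ a + (p - 1) * q) (k : Fin (n + 1)) :
    planeTransform p n (Vquot.evalMap p (a + (p - 1) * q) (Vquot.mono p _ ⟨a + k, by omega⟩)) =
      ((-1) ^ (n - k : ℕ) * (n.choose k : ZMod p)) • Vh.mono p n k := by
  have e : Vquot.evalMap p (a + (p - 1) * q) (Vquot.mono p _ ⟨a + k, by omega⟩) =
      fun v => v 0 ^ (a + (p - 1) * q - (a + k)) * v 1 ^ (a + k : ℕ) := by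
    ext v
    rw [Vquot.evalMap_mono]
  rw [e, planeTransform_monomial, Finset.sum_eq_single k]
  · have e1 : a + (p - 1) * q - (a + k) + k = (p - 1) * q := by omega
    have e2 : a + k + (n - k) = p - 1 := by omega
    rw [e1, e2, ZMod.sum_pow_of_dvd (by omega) (dvd_mul_right _ _),
      ZMod.sum_pow_of_dvd (by omega) dvd_rfl]
    norm_num
  · intro l _ hl
    rw [ZMod.sum_pow_of_not_dvd (i := a + k + (n - l)), mul_zero, zero_mul, zero_smul]
    intro hdvd
    apply hl
    ext
    obtain ⟨m, hm⟩ := hdvd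
    rcases m with _ | _ | m
    · omega
    · omega
    · have : (p - 1) * (m + 1 + 1) = (p - 1) * m + (p - 1) + (p - 1) := by ring
      omega
  · simp

theorem choose_cast_ne_zero {n k : ℕ} (hn : n < p) (hk : k ≤ n) : (n.choose k : ZMod p) ≠ 0 := by
  rw [Ne, ZMod.natCast_eq_zero_iff]
  intro h
  have hfact : p ∣ n.factorial := by
    rw [← Nat.choose_mul_factorial_mul_factorial hk]
    exact dvd_mul_of_dvd_left (dvd_mul_of_dvd_left h _) _
  exact absurd (((Fact.out : p.Prime).dvd_factorial).1 hfact) (by omega)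

/-- A linear section of the projection `V_r / V_r^* → V_n`, whose image contains
the classes of the monomials `X ^ (r - t) * Y ^ t` with `a ≤ t ≤ p - 1`. -/
theorem exists_section {a n q : ℕ} (ha : 1 ≤ a) (han : a + n = p - 1)
    (hpr : p ≤ a + (p - 1) * q) :
    ∃ σ : Vh p n →ₗ[ZMod p] Vquot p (a + (p - 1) * q),
      (planeTransform p n ∘ₗ Vquot.evalMap p _) ∘ₗ σ = LinearMap.id ∧
      ∀ k : Fin (n + 1), ∃ c : ZMod p,
        σ (c • Vh.mono p n k) = Vquot.mono p _ ⟨a + k, by omega⟩ := by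
  set u : Fin (n + 1) → ZMod p := fun k => (-1) ^ (n - k : ℕ) * (n.choose k : ZMod p)
  have hu : ∀ k, u k ≠ 0 := fun k =>
    mul_ne_zero (pow_ne_zero _ (neg_ne_zero.2 one_ne_zero))
      (choose_cast_ne_zero (by omega) (by omega))
  refine ⟨(Vh.basis p n).constr (ZMod p) fun k =>
    (u k)⁻¹ • Vquot.mono p _ ⟨a + k, by omega⟩, ?_, fun k => ⟨u k, ?_⟩⟩
  · refine (Vh.basis p n).ext fun k => ?_
    rw [LinearMap.comp_apply, Module.Basis.constr_basis, map_smul, LinearMap.comp_apply,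
      planeTransform_evalMap_mono ha han hpr, inv_smul_smul₀ (hu k), Vh.basis_apply,
      LinearMap.id_apply]
  · rw [← Vh.basis_apply, map_smul, Module.Basis.constr_basis, smul_inv_smul₀ (hu k)]

theorem ker_projection_eq_range {a n q : ℕ} (ha : 1 ≤ a) (han : a + n = p - 1)
    (hpr : p ≤ a + (p - 1) * q) {ι : Vh p a →ₗ[ZMod p] Vquot p (a + (p - 1) * q)}
    (hι : ∀ x, Vquot.evalMap p _ (ι x) = Vh.evalMap p a x) :
    LinearMap.ker (planeTransform p n ∘ₗ Vquot.evalMap p (a + (p - 1) * q)) =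
      LinearMap.range ι := by
  have hp : 2 ≤ p := (Fact.out : p.Prime).two_le
  obtain ⟨σ, hσ, hmono⟩ := exists_section ha han hpr
  set π := planeTransform p n ∘ₗ Vquot.evalMap p (a + (p - 1) * q)
  have hπι : ∀ x, π (ι x) = 0 := fun x => by
    rw [LinearMap.comp_apply, hι, planeTransform_evalMap ha han]
  apply le_antisymm
  · have hι_mem : ∀ w ∈ LinearMap.range ι, w - σ (π w) ∈ LinearMap.range ι := by
      rintro _ ⟨x, rfl⟩
      rw [hπι, map_zero, sub_zero]
      exact ⟨x, rfl⟩
    have hlast : Vquot.mono p (a + (p - 1) * q) (Fin.last _) ∈ LinearMap.range ι := by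
      refine ⟨Vh.mono p a (Fin.last a), Vquot.evalMap_injective hpr ?_⟩
      ext v
      rw [hι, Vh.evalMap_apply, Vh.eval_mono, Vquot.evalMap_mono, Fin.val_last, Fin.val_last,
        ZMod.pow_add_mul_card_sub_one ha]
      simp
    have hlow : ∀ t (ht : t < a),
        Vquot.mono p (a + (p - 1) * q) ⟨t, by omega⟩ ∈ LinearMap.range ι := by
      intro t ht
      refine ⟨Vh.mono p a ⟨t, by omega⟩, Vquot.evalMap_injective hpr ?_⟩
      ext v
      have e : a + (p - 1) * q - t = a - t + (p - 1) * q := by omega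
      rw [hι, Vh.evalMap_apply, Vh.eval_mono, Vquot.evalMap_mono, e,
        ZMod.pow_add_mul_card_sub_one (by omega)]
    have hall : ∀ w, w - σ (π w) ∈ LinearMap.range ι := by
      intro w
      suffices h : (⊤ : Submodule (ZMod p) _) ≤
          (LinearMap.range ι).comap (LinearMap.id - σ ∘ₗ π) from h (x := w) trivial
      rw [← Vquot.span_mono hp hpr, sup_le_iff, Submodule.span_le, Submodule.span_le]
      constructor
      · rintro _ ⟨t, rfl⟩
        change Vquot.mono p (a + (p - 1) * q) ⟨t, by omega⟩ -
          σ (π (Vquot.mono p (a + (p - 1) * q) ⟨t, by omega⟩)) ∈ LinearMap.range ι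
        by_cases ht : (t : ℕ) < a
        · exact hι_mem _ (hlow t ht)
        · obtain ⟨c, hc⟩ := hmono ⟨t - a, by omega⟩
          have e : a + (t - a : ℕ) = t := by omega
          simp only [e] at hc
          rw [← hc, ← LinearMap.comp_apply π σ, hσ, LinearMap.id_apply, sub_self]
          exact Submodule.zero_mem _
      · rintro _ rfl
        exact hι_mem _ hlast
    intro w hw
    have h := hall w
    rwa [LinearMap.mem_ker.1 hw, map_zero, sub_zero] at h
  · rintro _ ⟨x, rfl⟩
    exact hπι x

theorem exists_pow_ne_one {m : ℕ} (hm : ¬ p - 1 ∣ m) : ∃ d : ZMod p, d ≠ 0 ∧ d ^ m ≠ 1 := by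
  by_contra! h
  apply hm
  rw [← ZMod.card p, ← FiniteField.forall_pow_eq_one_iff (ZMod p)]
  intro x
  ext
  simpa using h x x.ne_zero

theorem exists_isUnit_vecMul_eq {v : Fin 2 → ZMod p} (hv : v ≠ 0) :
    ∃ g : Matrix (Fin 2) (Fin 2) (ZMod p), IsUnit g ∧ Matrix.vecMul ![1, 0] g = v := by
  by_cases h0 : v 0 = 0
  · have h1 : v 1 ≠ 0 := fun h1 => hv (by ext i; fin_cases i <;> simp [h0, h1])
    refine ⟨!![v 0, v 1; 1, 0], ?_, ?_⟩
    · rw [Matrix.isUnit_iff_isUnit_det, isUnit_iff_ne_zero, Matrix.det_fin_two_of]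
      simpa using h1
    · ext i; fin_cases i <;> simp [Matrix.vecMul, dotProduct]
  · refine ⟨!![v 0, v 1; 0, 1], ?_, ?_⟩
    · rw [Matrix.isUnit_iff_isUnit_det, isUnit_iff_ne_zero, Matrix.det_fin_two_of]
      simpa using h0
    · ext i; fin_cases i <;> simp [Matrix.vecMul, dotProduct]

/-- For `n > 0` and `a + n = p - 1`, every equivariant map from `V_n ⊗ D^a` to `V_r / V_r^*`
evaluates to zero. -/
theorem evalMap_equivariant_eq_zero {a n r : ℕ} (ha : 1 ≤ a) (hn : 1 ≤ n) (han : a + n = p - 1)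
    (hr : 0 < r) (s : Vh p n →ₗ[ZMod p] Vquot p r)
    (hs : ∀ g : Matrix (Fin 2) (Fin 2) (ZMod p), IsUnit g → ∀ x y : Vh p n,
      (y : MvPolynomial (Fin 2) (ZMod p)) = twAct p a g x →
      ∀ v, Vquot.evalMap p r (s y) v = Vquot.evalMap p r (s x) (Matrix.vecMul v g))
    (x : Vh p n) : Vquot.evalMap p r (s x) = 0 := by
  set l : Vh p n →ₗ[ZMod p] ZMod p := LinearMap.proj ![1, 0] ∘ₗ Vquot.evalMap p r ∘ₗ s
  have hl : ∀ g : Matrix (Fin 2) (Fin 2) (ZMod p), IsUnit g → Matrix.vecMul ![1, 0] g = ![1, 0] →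
      ∀ x y : Vh p n, (y : MvPolynomial (Fin 2) (ZMod p)) = twAct p a g x → l y = l x := by
    intro g hg hg1 x y hxy
    change Vquot.evalMap p r (s y) ![1, 0] = Vquot.evalMap p r (s x) ![1, 0]
    rw [hs g hg x y hxy, hg1]
  have hl_lt : ∀ k : Fin (n + 1), (k : ℕ) < n → l (Vh.mono p n k) = 0 := by
    intro k hk
    obtain ⟨d, hd0, hd⟩ := exists_pow_ne_one (p := p) (m := a + k)
      fun h => absurd (Nat.le_of_dvd (by omega) h) (by omega)
    have h := hl !![1, 0; 0, d]
      (by rw [Matrix.isUnit_iff_isUnit_det, isUnit_iff_ne_zero, Matrix.det_fin_two_of]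
          simpa using hd0)
      (by ext i; fin_cases i <;> simp [Matrix.vecMul, dotProduct])
      (Vh.mono p n k) (d ^ (a + k : ℕ) • Vh.mono p n k) (by
        simp only [Submodule.coe_smul, twAct, Vh.mono, matAct, map_mul, map_pow, aeval_X,
          Fin.sum_univ_two, Matrix.det_fin_two_of, smul_eq_C_mul]
        simp
        ring)
    rw [map_smul, smul_eq_mul] at h
    by_contra h0
    exact hd (mul_right_cancel₀ h0 (by rw [h, one_mul]))
  have hl_last : l (Vh.mono p n (Fin.last n)) = 0 := by
    have h := hl !![1, 0; 1, 1]
      (by rw [Matrix.isUnit_iff_isUnit_det, isUnit_iff_ne_zero, Matrix.det_fin_two_of]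
          simp)
      (by ext i; fin_cases i <;> simp [Matrix.vecMul, dotProduct])
      (Vh.mono p n ⟨n - 1, by omega⟩)
      (Vh.mono p n ⟨n - 1, by omega⟩ + Vh.mono p n (Fin.last n)) (by
        obtain ⟨m, rfl⟩ := Nat.exists_eq_add_of_le' hn
        simp only [Submodule.coe_add, twAct, Vh.mono, matAct, map_mul, map_pow, aeval_X,
          Fin.sum_univ_two, Matrix.det_fin_two_of, smul_eq_C_mul]
        simp
        ring)
    rw [map_add] at h
    exact left_eq_add.1 h.symm
  have hl0 : l = 0 := by
    refine (Vh.basis p n).ext fun k => ?_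
    rw [Vh.basis_apply, LinearMap.zero_apply]
    by_cases hk : (k : ℕ) < n
    · exact hl_lt k hk
    · obtain rfl : k = Fin.last n := Fin.ext (by rw [Fin.val_last]; omega)
      exact hl_last
  ext v
  rw [Pi.zero_apply]
  by_cases hv : v = 0
  · subst hv
    obtain ⟨F, hF⟩ := Submodule.Quotient.mk_surjective _ (s x)
    rw [← hF, Vquot.evalMap_mk, eval_zero_of_mem_Vh hr F.2]
  · obtain ⟨g, hg, rfl⟩ := exists_isUnit_vecMul_eq hv
    rw [← hs g hg x ⟨twAct p a g x, Submodule.smul_mem _ _ (matAct_mem_Vh g x.2)⟩ rfl]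
    exact LinearMap.congr_fun hl0 _

theorem exists_equivariant_section {a q : ℕ} (ha : 1 ≤ a) (hap : a = p - 1)
    (hpr : p ≤ a + (p - 1) * q) :
    ∃ s : Vh p 0 →ₗ[ZMod p] Vquot p (a + (p - 1) * q),
      (planeTransform p 0 ∘ₗ Vquot.evalMap p _) ∘ₗ s = LinearMap.id ∧
      ∀ g : Matrix (Fin 2) (Fin 2) (ZMod p), IsUnit g → ∀ x y : Vh p 0,
        (y : MvPolynomial (Fin 2) (ZMod p)) = twAct p a g x →
        ∀ v, Vquot.evalMap p _ (s y) v = Vquot.evalMap p _ (s x) (Matrix.vecMul v g) := by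
  have hconst : ∀ x : Vh p 0, ∃ c, (x : MvPolynomial (Fin 2) (ZMod p)) = C c := fun x =>
    ⟨_, totalDegree_eq_zero_iff_eq_C.1
      ((totalDegree_zero_iff_isHomogeneous _).2 ((mem_homogeneousSubmodule 0 _).1 x.2))⟩
  set E : Vquot p (a + (p - 1) * q) :=
    Vquot.mono p _ ⟨a, by omega⟩ - Vquot.mono p _ 0 - Vquot.mono p _ (Fin.last _)
  have hq : 0 < (p - 1) * q := by
    have : 2 ≤ p := (Fact.out : p.Prime).two_le
    omega
  have hE : ∀ v, Vquot.evalMap p _ E v = if v = 0 then 0 else -1 := by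
    intro v
    have hpow : ∀ (m : ℕ) (x : ZMod p), 0 < (p - 1) * m →
        x ^ ((p - 1) * m) = if x = 0 then 0 else 1 := by
      intro m x hm
      split_ifs with hx
      · rw [hx, zero_pow hm.ne']
      · rw [pow_mul, ZMod.pow_card_sub_one_eq_one hx, one_pow]
    have hv : v = 0 ↔ v 0 = 0 ∧ v 1 = 0 := by
      rw [_root_.funext_iff, Fin.forall_fin_two]
      rfl
    have e1 : a + (p - 1) * q - a = (p - 1) * q := by omega
    have e2 : a + (p - 1) * q = (p - 1) * (q + 1) := by rw [hap]; ring
    have hv1 := hpow 1 (v 1) (by omega)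
    rw [mul_one, ← hap] at hv1
    simp only [E, map_sub, Pi.sub_apply, Vquot.evalMap_mono, e1, Fin.val_last, Fin.val_zero,
      Nat.sub_self, pow_zero, mul_one, one_mul, Nat.sub_zero, hv1, hpow q _ hq]
    rw [e2, hpow _ _ (by rw [← e2]; omega), hpow _ _ (by rw [← e2]; omega)]
    by_cases h0 : v 0 = 0 <;> by_cases h1 : v 1 = 0 <;> simp [hv, h0, h1]
  have hπE : planeTransform p 0 (Vquot.evalMap p _ E) = Vh.mono p 0 0 := by
    have h1 := planeTransform_evalMap_mono (p := p) (q := q) ha (n := 0) hap hpr 0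
    have hfun0 : Vquot.evalMap p (a + (p - 1) * q) (Vquot.mono p _ 0) =
        fun v => v 0 ^ (a + (p - 1) * q) * v 1 ^ 0 := by
      ext v; rw [Vquot.evalMap_mono]; simp
    have hfun1 : Vquot.evalMap p (a + (p - 1) * q) (Vquot.mono p _ (Fin.last _)) =
        fun v => v 0 ^ 0 * v 1 ^ (a + (p - 1) * q) := by
      ext v; rw [Vquot.evalMap_mono]; simp
    simp only [Fin.val_zero, add_zero] at h1
    rw [map_sub, map_sub, map_sub, map_sub, h1, hfun0, hfun1, planeTransform_monomial,
      planeTransform_monomial]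
    simp
  refine ⟨(LinearMap.proj 0 ∘ₗ Vh.evalMap p 0).smulRight E, ?_, ?_⟩
  · ext1 x
    obtain ⟨c, hc⟩ := hconst x
    rw [LinearMap.comp_apply, LinearMap.smulRight_apply, map_smul, LinearMap.comp_apply,
      LinearMap.comp_apply, hπE]
    apply Subtype.ext
    simp [Vh.evalMap_apply, Vh.mono, hc, smul_eq_C_mul]
  · intro g hg x y hxy v
    obtain ⟨c, hc⟩ := hconst x
    have hdet : g.det ^ a = 1 := by
      rw [hap, ZMod.pow_card_sub_one_eq_one]
      exact ((Matrix.isUnit_iff_isUnit_det g).1 hg).ne_zero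
    obtain rfl : y = x := by
      apply Subtype.ext
      rw [hxy, twAct, hdet, one_smul, hc, algHom_C, algebraMap_eq]
    have hg0 : Matrix.vecMul v g = 0 ↔ v = 0 :=
      ⟨fun h => Matrix.vecMul_injective_iff_isUnit.2 hg (h.trans (Matrix.zero_vecMul g).symm),
        fun h => by rw [h, Matrix.zero_vecMul]⟩
    simp only [LinearMap.smulRight_apply, map_smul, Pi.smul_apply, hE, hg0]

end Sequence

/-- For a prime `p ≥ 3` and `r ≥ p` with `r ≡ a mod (p−1)`,
`1 ≤ a ≤ p−1`, there is a short exact sequence of `Γ = GL_2(F_p)`-equivariant maps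
`0 → V_a → V_r/V_r^* → V_{p−a−1} ⊗ D^a → 0`, and it splits (i.e. the surjection admits a
`Γ`-equivariant linear section) if and only if `a = p − 1`. -/
theorem Vr_mod_Vstar_ses (p r a : ℕ) (hp : p.Prime) (hp3 : 3 ≤ p) (hpr : p ≤ r)
    (ha : 1 ≤ a) (ha2 : a ≤ p - 1) (hmod : r ≡ a [MOD p - 1]) :
    ∃ (ι : ↥(Vh p a) →ₗ[ZMod p] (↥(Vh p r) ⧸ (Vstar p r).comap (Vh p r).subtype))
      (π : (↥(Vh p r) ⧸ (Vstar p r).comap (Vh p r).subtype) →ₗ[ZMod p]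
        ↥(Vh p (p - a - 1))),
      Function.Injective ι ∧ Function.Surjective π ∧
      LinearMap.ker π = LinearMap.range ι ∧
      -- `Γ`-equivariance of `ι` (on the quotient, via representatives)
      (∀ g : Matrix (Fin 2) (Fin 2) (ZMod p), IsUnit g →
        ∀ (x y : ↥(Vh p a)) (F F' : ↥(Vh p r)),
          (y : MvPolynomial (Fin 2) (ZMod p)) = matAct p g (x : MvPolynomial (Fin 2) (ZMod p)) →
          ι x = Submodule.Quotient.mk F →
          (F' : MvPolynomial (Fin 2) (ZMod p)) = matAct p g (F : MvPolynomial (Fin 2) (ZMod p)) →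
          ι y = Submodule.Quotient.mk F') ∧
      -- `Γ`-equivariance of `π`
      (∀ g : Matrix (Fin 2) (Fin 2) (ZMod p), IsUnit g →
        ∀ (F F' : ↥(Vh p r)),
          (F' : MvPolynomial (Fin 2) (ZMod p)) = matAct p g (F : MvPolynomial (Fin 2) (ZMod p)) →
          (π (Submodule.Quotient.mk F') : MvPolynomial (Fin 2) (ZMod p)) =
            twAct p a g (π (Submodule.Quotient.mk F) : MvPolynomial (Fin 2) (ZMod p))) ∧
      -- the sequence splits iff `a = p − 1`
      ((∃ s : ↥(Vh p (p - a - 1)) →ₗ[ZMod p]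
            (↥(Vh p r) ⧸ (Vstar p r).comap (Vh p r).subtype),
          π.comp s = LinearMap.id ∧
          ∀ g : Matrix (Fin 2) (Fin 2) (ZMod p), IsUnit g →
            ∀ (x y : ↥(Vh p (p - a - 1))) (F F' : ↥(Vh p r)),
              (y : MvPolynomial (Fin 2) (ZMod p)) =
                twAct p a g (x : MvPolynomial (Fin 2) (ZMod p)) →
              s x = Submodule.Quotient.mk F →
              (F' : MvPolynomial (Fin 2) (ZMod p)) =
                matAct p g (F : MvPolynomial (Fin 2) (ZMod p)) →
              s y = Submodule.Quotient.mk F') ↔ a = p - 1) := by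
  have := Fact.mk hp
  obtain ⟨q, rfl⟩ : ∃ q, r = a + (p - 1) * q := by
    obtain ⟨q, hq⟩ := (Nat.modEq_iff_dvd' (by omega)).1 hmod.symm
    exact ⟨q, by omega⟩
  obtain ⟨n, hn⟩ : ∃ n, n = p - a - 1 := ⟨_, rfl⟩
  have han : a + n = p - 1 := by omega
  rw [← hn]
  obtain ⟨ι, hι⟩ := exists_inclusion (p := p) ha hpr
  obtain ⟨σ, hσ, -⟩ := exists_section (p := p) ha han hpr
  refine ⟨ι, planeTransform p n ∘ₗ Vquot.evalMap p _, ?_,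
    fun x => ⟨σ x, LinearMap.congr_fun hσ x⟩, ker_projection_eq_range ha han hpr hι, ?_, ?_, ?_, ?_⟩
  · intro x y hxy
    apply Vh.evalMap_injective (p := p) (m := a) (by omega)
    rw [← hι, ← hι, hxy]
  · intro g _ x y F F' hy hF hF'
    rw [Vquot.eq_mk_iff hpr]
    intro v
    rw [hι, Vh.evalMap_apply, hy, hF', eval_matAct, eval_matAct, ← Vh.evalMap_apply, ← hι, hF,
      Vquot.evalMap_mk]
  · intro g hg F F' hF'
    have hdet : g.det ^ a * g.det ^ n = 1 := by
      rw [← pow_add, han, ZMod.pow_card_sub_one_eq_one]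
      exact ((Matrix.isUnit_iff_isUnit_det g).1 hg).ne_zero
    rw [LinearMap.comp_apply, LinearMap.comp_apply, twAct, matAct_planeTransform n hg, smul_smul,
      hdet, one_smul]
    congr 2
    ext v
    rw [Vquot.evalMap_mk, Vquot.evalMap_mk, hF', eval_matAct]
  · rintro ⟨s, hs, hequiv⟩
    by_contra hap
    have hzero := evalMap_equivariant_eq_zero ha (by omega) han (by omega) s fun g hg x y hxy v => by
      obtain ⟨F, hF⟩ := Submodule.Quotient.mk_surjective _ (s x)
      rw [hequiv g hg x y F ⟨matAct p g F, matAct_mem_Vh g F.2⟩ hxy hF.symm rfl, ← hF,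
        Vquot.evalMap_mk, Vquot.evalMap_mk, eval_matAct]
    apply (Vh.linearIndependent_mono (p := p) n).ne_zero 0
    rw [← LinearMap.id_apply (R := ZMod p) (Vh.mono p n 0), ← hs, LinearMap.comp_apply,
      LinearMap.comp_apply, hzero, map_zero]
  · intro hap
    obtain rfl : n = 0 := by omega
    obtain ⟨s, hs, hequiv⟩ := exists_equivariant_section ha hap hpr
    refine ⟨s, hs, fun g hg x y F F' hy hF hF' => (Vquot.eq_mk_iff hpr).2 fun v => ?_⟩
    rw [hequiv g hg x y hy, hF, hF', eval_matAct, Vquot.evalMap_mk]
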